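/- The equation f_ν'(1) = 0 has exactly one root ν₀ in the interval (−1, ∞), and this root satisfies −0.57 < ν₀ < −0.56. -/

import Mathlib

noncomputable section

/-- The normalized Bessel function of the first kind (real restriction),
`f_ν(x) = ∑ (−1)^n Γ(ν+1) x^(n+1) / (4^n n! Γ(ν+n+1))`. -/
def besselFR (ν : ℝ) (x : ℝ) : ℝ :=
  ∑' n : ℕ, ((-1 : ℝ) ^ n * Real.Gamma (ν + 1) * x ^ (n + 1)) /
    (4 ^ n * n.factorial * Real.Gamma (ν + n + 1))

open Finset Real

/-- The reciprocal of the shifted rising factorial `(a + 1) ⋯ (a + n)`. -/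
def invRising (n : ℕ) (a : ℝ) : ℝ := ∏ i ∈ range n, (a + (i + 1))⁻¹

/-- The absolute weights of the terms of index at least two in `f_ν'(1)`. -/
def besselWeight (m : ℕ) : ℝ := (m + 3) / (4 ^ (m + 2) * (m + 2).factorial)

/-- The series `a * f_{a-1}'(1)`, with its first two terms written out. -/
def besselAux (a : ℝ) : ℝ :=
  a - 1 / 2 + ∑' m : ℕ, (-1 : ℝ) ^ m * besselWeight m * invRising (m + 1) a

lemma Gamma_add_nat_eq_prod {a : ℝ} (ha : 0 < a) (n : ℕ) :
    Gamma (a + n) = Gamma a * ∏ i ∈ range n, (a + i) := by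
  induction n with
  | zero => simp
  | succ n ih =>
    rw [prod_range_succ, Nat.cast_succ, ← add_assoc, Gamma_add_one (by positivity), ih]
    ring

lemma invRising_succ (n : ℕ) (a : ℝ) :
    invRising (n + 1) a = invRising n a * (a + (n + 1))⁻¹ := prod_range_succ _ _

lemma invRising_nonneg {a : ℝ} (ha : 0 ≤ a) (n : ℕ) : 0 ≤ invRising n a :=
  prod_nonneg fun i _ => by positivity

lemma invRising_le_one {a : ℝ} (ha : 0 ≤ a) (n : ℕ) : invRising n a ≤ 1 :=
  prod_le_one (fun i _ => by positivity) fun i _ =>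
    inv_le_one_of_one_le₀ (by linarith [Nat.cast_nonneg (α := ℝ) i])

lemma abs_invRising_sub_le {a b : ℝ} (ha : 0 ≤ a) (hb : 0 ≤ b) (n : ℕ) :
    |invRising n a - invRising n b| ≤ |a - b| := by
  induction n with
  | zero => simp [invRising]
  | succ n ih =>
    have hA : 0 < a + (n + 1) := by positivity
    have hB : 0 < b + (n + 1) := by positivity
    have hinv : ∀ x : ℝ, 0 ≤ x → (x + (n + 1))⁻¹ ≤ ((n : ℝ) + 1)⁻¹ := fun x hx =>
      inv_anti₀ (by positivity) (by linarith)
    have hn : ((n : ℝ) + 1)⁻¹ ≤ 1 :=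
      inv_le_one_of_one_le₀ (by linarith [Nat.cast_nonneg (α := ℝ) n])
    have hstep : |(a + (n + 1))⁻¹ - (b + (n + 1))⁻¹| ≤ |a - b| * ((n : ℝ) + 1)⁻¹ := by
      have : (a + (n + 1))⁻¹ - (b + (n + 1))⁻¹ =
          (b - a) * ((a + (n + 1))⁻¹ * (b + (n + 1))⁻¹) := by
        field_simp
        ring
      rw [this, abs_mul, abs_sub_comm b a, abs_of_pos (a := _ * _) (by positivity)]
      gcongr
      calc _ ≤ ((n : ℝ) + 1)⁻¹ * 1 :=
            mul_le_mul (hinv a ha) ((hinv b hb).trans hn) (by positivity) (by positivity)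
        _ = _ := mul_one _
    have hsplit : invRising (n + 1) a - invRising (n + 1) b =
        (invRising n a - invRising n b) * (a + (n + 1))⁻¹ +
          invRising n b * ((a + (n + 1))⁻¹ - (b + (n + 1))⁻¹) := by
      rw [invRising_succ, invRising_succ]
      ring
    have h2 : |invRising n b * ((a + (n + 1))⁻¹ - (b + (n + 1))⁻¹)| ≤
        |a - b| * ((n : ℝ) + 1)⁻¹ := by
      rw [abs_mul, abs_of_nonneg (invRising_nonneg hb n)]
      exact (mul_le_of_le_one_left (abs_nonneg _) (invRising_le_one hb n)).trans hstep
    rcases Nat.eq_zero_or_pos n with rfl | hpos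
    · rw [hsplit]
      simpa [invRising] using h2
    · have h1 : |(invRising n a - invRising n b) * (a + (n + 1))⁻¹| ≤
          |a - b| * ((n : ℝ) + 1)⁻¹ := by
        rw [abs_mul, abs_of_pos (inv_pos.2 hA)]
        exact mul_le_mul ih (hinv a ha) (by positivity) (abs_nonneg _)
      have hhalf : ((n : ℝ) + 1)⁻¹ ≤ 2⁻¹ := by
        have : (1 : ℝ) ≤ n := by exact_mod_cast hpos
        exact inv_anti₀ (by norm_num) (by linarith)
      rw [hsplit]
      refine (abs_add_le _ _).trans ?_
      nlinarith [abs_nonneg (a - b)]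

lemma besselWeight_nonneg (m : ℕ) : 0 ≤ besselWeight m := by
  unfold besselWeight
  positivity

lemma besselWeight_succ_le (m : ℕ) : besselWeight (m + 1) ≤ besselWeight m * (1 / 4) := by
  unfold besselWeight
  rw [div_mul_div_comm, div_le_div_iff₀ (by positivity) (by positivity),
    show m + 1 + 2 = (m + 2) + 1 by ring, Nat.factorial_succ (m + 2), pow_succ (4 : ℝ) (m + 2)]
  push_cast
  have h : (0 : ℝ) ≤ 4 ^ (m + 2) * (m + 2).factorial := by positivity
  have hm : (0 : ℝ) ≤ m := by positivity
  have key : (m + 1 + 3 : ℝ) ≤ (m + 3) * (m + 2 + 1) := by nlinarith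
  have := mul_le_mul_of_nonneg_left key h
  linarith

lemma besselWeight_add_le (k m : ℕ) :
    besselWeight (m + k) ≤ besselWeight k * (1 / 4) ^ m := by
  induction m with
  | zero => simp
  | succ m ih =>
    rw [show m + 1 + k = (m + k) + 1 by ring, pow_succ, ← mul_assoc]
    exact (besselWeight_succ_le _).trans (by gcongr)

lemma hasSum_mul_quarter_pow (c : ℝ) : HasSum (fun m : ℕ => c * (1 / 4 : ℝ) ^ m) (c * (4 / 3)) := by
  have := (hasSum_geometric_of_lt_one (r := (1 / 4 : ℝ)) (by norm_num) (by norm_num)).mul_left c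
  norm_num at this ⊢
  exact this

lemma norm_besselAux_term_le {a : ℝ} (ha : 0 ≤ a) (m : ℕ) :
    ‖(-1 : ℝ) ^ m * besselWeight m * invRising (m + 1) a‖ ≤ besselWeight m := by
  rw [norm_mul, norm_mul, norm_pow, norm_neg, norm_one, one_pow, one_mul,
    norm_of_nonneg (besselWeight_nonneg m), norm_of_nonneg (invRising_nonneg ha _)]
  exact mul_le_of_le_one_right (besselWeight_nonneg m) (invRising_le_one ha _)

lemma summable_besselAux {a : ℝ} (ha : 0 ≤ a) :
    Summable fun m : ℕ => (-1 : ℝ) ^ m * besselWeight m * invRising (m + 1) a :=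
  Summable.of_norm_bounded (hasSum_mul_quarter_pow (besselWeight 0)).summable fun m =>
    (norm_besselAux_term_le ha m).trans (besselWeight_add_le 0 m)

/-- The tail of `besselAux` is a contraction. -/
lemma abs_besselAux_sub_sub_le {a b : ℝ} (ha : 0 ≤ a) (hb : 0 ≤ b) :
    |besselAux a - besselAux b - (a - b)| ≤ |a - b| * (1 / 8) := by
  have heq : besselAux a - besselAux b - (a - b) = ∑' m : ℕ,
      ((-1 : ℝ) ^ m * besselWeight m * invRising (m + 1) a -
        (-1 : ℝ) ^ m * besselWeight m * invRising (m + 1) b) := by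
    rw [(summable_besselAux ha).tsum_sub (summable_besselAux hb)]
    unfold besselAux
    ring
  have h0 : besselWeight 0 = 3 / 32 := by norm_num [besselWeight, Nat.factorial]
  have hs := hasSum_mul_quarter_pow (|a - b| * besselWeight 0)
  rw [heq, ← norm_eq_abs]
  refine (tsum_of_norm_bounded hs fun m => ?_).trans (le_of_eq (by rw [h0]; ring))
  rw [← mul_sub, norm_mul, norm_mul, norm_pow, norm_neg, norm_one, one_pow, one_mul,
    norm_of_nonneg (besselWeight_nonneg m), norm_eq_abs, mul_comm, mul_assoc]
  exact mul_le_mul (abs_invRising_sub_le ha hb _) (besselWeight_add_le 0 m)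
    (besselWeight_nonneg m) (abs_nonneg _)

lemma besselAux_strictMonoOn : StrictMonoOn besselAux (Set.Ici 0) := by
  intro a ha b hb hab
  have h := abs_besselAux_sub_sub_le hb ha
  rw [abs_of_pos (sub_pos.2 hab)] at h
  linarith [(abs_le.1 h).1]

lemma besselAux_continuousOn : ContinuousOn besselAux (Set.Ici 0) := by
  refine (LipschitzOnWith.of_dist_le_mul (K := 2) fun a ha b hb => ?_).continuousOn
  have h := abs_besselAux_sub_sub_le ha hb
  have h2 := abs_add_le (besselAux a - besselAux b - (a - b)) (a - b)
  rw [sub_add_cancel] at h2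
  rw [dist_eq, dist_eq]
  push_cast
  linarith [abs_nonneg (a - b)]

lemma abs_besselAux_sub_partial_le {a : ℝ} (ha : 0 ≤ a) :
    |besselAux a - (a - 1 / 2 + 3 / 32 * (a + 1)⁻¹ - 1 / 96 * ((a + 1)⁻¹ * (a + 2)⁻¹))| ≤
      5 / 4608 := by
  have hs := hasSum_mul_quarter_pow (besselWeight 2)
  have h0 : besselWeight 0 = 3 / 32 := by norm_num [besselWeight, Nat.factorial]
  have h1 : besselWeight 1 = 1 / 96 := by norm_num [besselWeight, Nat.factorial]
  have h2 : besselWeight 2 = 5 / 6144 := by norm_num [besselWeight, Nat.factorial]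
  have heq : besselAux a -
      (a - 1 / 2 + 3 / 32 * (a + 1)⁻¹ - 1 / 96 * ((a + 1)⁻¹ * (a + 2)⁻¹)) =
      ∑' m : ℕ, (-1 : ℝ) ^ (m + 2) * besselWeight (m + 2) * invRising (m + 2 + 1) a := by
    unfold besselAux
    rw [← (summable_besselAux ha).sum_add_tsum_nat_add 2, sum_range_succ, sum_range_one, h0, h1]
    norm_num [invRising, prod_range_succ]
    ring
  rw [heq, ← norm_eq_abs]
  refine (tsum_of_norm_bounded hs fun m => ?_).trans (le_of_eq (by rw [h2]; norm_num))
  exact (norm_besselAux_term_le ha _).trans (besselWeight_add_le 2 m)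

lemma inv_prod_range_succ_add {a : ℝ} (n : ℕ) :
    (∏ i ∈ range (n + 1), (a + i))⁻¹ = a⁻¹ * invRising n a := by
  rw [prod_range_succ', invRising, prod_inv_distrib, mul_inv]
  push_cast
  rw [add_zero, mul_comm]

/-- The Taylor coefficients of the normalized Bessel function `f_{a-1}`. -/
def besselCoeff (a : ℝ) (n : ℕ) : ℝ :=
  (-1) ^ n / (4 ^ n * n.factorial) * (∏ i ∈ range n, (a + i))⁻¹

lemma besselFR_eq_tsum {ν : ℝ} (hν : -1 < ν) (x : ℝ) :
    besselFR ν x = ∑' n : ℕ, besselCoeff (ν + 1) n * x ^ (n + 1) := by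
  have ha : 0 < ν + 1 := by linarith
  refine tsum_congr fun n => ?_
  have hΓ := (Gamma_pos_of_pos ha).ne'
  have hP : ∏ i ∈ range n, (ν + 1 + i) ≠ 0 := prod_ne_zero_iff.2 fun i _ => by positivity
  rw [show ν + n + 1 = ν + 1 + n by ring, Gamma_add_nat_eq_prod ha, besselCoeff]
  field_simp

lemma abs_besselCoeff_mul_le {a : ℝ} (ha : 0 < a) (n : ℕ) :
    |besselCoeff a n * (n + 1)| ≤ 2 * (1 + a⁻¹) * (1 / 4) ^ n := by
  have hprod : |(∏ i ∈ range n, (a + i))⁻¹| ≤ 1 + a⁻¹ := by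
    have hi : 0 < a⁻¹ := inv_pos.2 ha
    cases n with
    | zero => simp [hi.le]
    | succ n =>
      rw [inv_prod_range_succ_add, abs_of_nonneg (mul_nonneg hi.le (invRising_nonneg ha.le n))]
      nlinarith [invRising_le_one ha.le n]
  have hfac : ((n : ℝ) + 1) / n.factorial ≤ 2 := by
    rw [div_le_iff₀ (by positivity)]
    have : n + 1 ≤ 2 * n.factorial := by
      have := n.self_le_factorial
      have := n.factorial_pos
      omega
    exact_mod_cast this
  have heq : besselCoeff a n * (n + 1) =
      (-1) ^ n * (((n : ℝ) + 1) / n.factorial * (∏ i ∈ range n, (a + i))⁻¹ * (1 / 4) ^ n) := by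
    rw [besselCoeff, one_div_pow]
    ring
  rw [heq, abs_mul, abs_pow, abs_neg, abs_one, one_pow, one_mul, abs_mul, abs_mul,
    abs_of_nonneg (a := _ / _) (by positivity), abs_of_nonneg (a := _ ^ n) (by positivity)]
  gcongr

lemma hasDerivAt_besselFR_one {ν : ℝ} (hν : -1 < ν) :
    HasDerivAt (besselFR ν) (∑' n : ℕ, besselCoeff (ν + 1) n * (n + 1)) 1 := by
  have ha : 0 < ν + 1 := by linarith
  have hfun : besselFR ν = fun x => ∑' n : ℕ, besselCoeff (ν + 1) n * x ^ (n + 1) :=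
    funext (besselFR_eq_tsum hν)
  have hu : Summable fun n : ℕ => 2 * (1 + (ν + 1)⁻¹) * (1 / 2 : ℝ) ^ n :=
    summable_geometric_two.mul_left _
  have h := hasDerivAt_tsum_of_isPreconnected (t := Metric.ball (0 : ℝ) 2)
    (g := fun (n : ℕ) x => besselCoeff (ν + 1) n * x ^ (n + 1))
    (g' := fun (n : ℕ) x => besselCoeff (ν + 1) n * ((n + 1) * x ^ n))
    (y₀ := 0) (y := 1) hu Metric.isOpen_ball (convex_ball _ _).isPreconnected
    (fun n x _ => by
      have := (hasDerivAt_pow (n + 1) x).const_mul (besselCoeff (ν + 1) n)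
      push_cast at this
      simpa using this)
    (fun n x hx => by
      have hx2 : |x| ≤ 2 := by
        simpa using (mem_ball_zero_iff.1 hx).le
      rw [← mul_assoc, norm_mul, norm_pow, norm_eq_abs, norm_eq_abs]
      calc _ ≤ 2 * (1 + (ν + 1)⁻¹) * (1 / 4) ^ n * 2 ^ n :=
            mul_le_mul (abs_besselCoeff_mul_le ha n)
              (pow_le_pow_left₀ (abs_nonneg _) hx2 n) (by positivity) (by positivity)
        _ = _ := by
            rw [mul_assoc, ← mul_pow]
            norm_num)
    (by simp) (by simp) (by simp)
  rw [hfun]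
  simpa using h

lemma mul_deriv_besselFR_one {ν : ℝ} (hν : -1 < ν) :
    (ν + 1) * deriv (besselFR ν) 1 = besselAux (ν + 1) := by
  have ha : 0 < ν + 1 := by linarith
  have hs : Summable fun n : ℕ => besselCoeff (ν + 1) n * (n + 1) :=
    Summable.of_norm_bounded (hasSum_mul_quarter_pow _).summable (abs_besselCoeff_mul_le ha)
  rw [(hasDerivAt_besselFR_one hν).deriv, ← hs.sum_add_tsum_nat_add 2, mul_add, ← tsum_mul_left,
    besselAux]
  congr 1
  · simp only [besselCoeff, sum_range_succ, prod_range_succ]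
    norm_num [Nat.factorial]
    field_simp
    ring
  · refine tsum_congr fun m => ?_
    rw [besselCoeff, inv_prod_range_succ_add, besselWeight, pow_add]
    push_cast
    field_simp
    ring

/-- The equation `f_ν'(1) = 0` has exactly one root `ν₀` in `(-1, ∞)`, and
`-0.57 < ν₀ < -0.56`. -/
theorem besselF_deriv_one_root : ∃ ν₀ : ℝ, (-1 < ν₀ ∧ deriv (besselFR ν₀) 1 = 0) ∧
    (∀ ν : ℝ, -1 < ν → deriv (besselFR ν) 1 = 0 → ν = ν₀) ∧
    -0.57 < ν₀ ∧ ν₀ < -0.56 := by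
  have hlo : besselAux 0.43 < 0 := by
    have h := (abs_le.1 (abs_besselAux_sub_partial_le (a := 0.43) (by norm_num))).2
    norm_num at h ⊢
    linarith
  have hhi : 0 < besselAux 0.44 := by
    have h := (abs_le.1 (abs_besselAux_sub_partial_le (a := 0.44) (by norm_num))).1
    norm_num at h ⊢
    linarith
  obtain ⟨a, ⟨ha1, ha2⟩, ha⟩ := intermediate_value_Ioo (by norm_num : (0.43 : ℝ) ≤ 0.44)
    (besselAux_continuousOn.mono fun x hx => le_trans (by norm_num) hx.1) ⟨hlo, hhi⟩
  have hapos : 0 < a := lt_trans (by norm_num) ha1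
  refine ⟨a - 1, ⟨by linarith, ?_⟩, fun ν hν h => ?_, by norm_num at ha1 ⊢; linarith,
    by norm_num at ha2 ⊢; linarith⟩
  · have h := mul_deriv_besselFR_one (ν := a - 1) (by linarith)
    rw [sub_add_cancel, ha] at h
    exact (mul_eq_zero.1 h).resolve_left hapos.ne'
  · have h' := mul_deriv_besselFR_one hν
    rw [h, mul_zero] at h'
    have := besselAux_strictMonoOn.injOn (by simp; linarith : ν + 1 ∈ Set.Ici (0 : ℝ))
      (hapos.le : a ∈ Set.Ici (0 : ℝ)) (h'.symm.trans ha.symm)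
    linarith
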